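/- arXiv:2304.04102 — 2 statements merged into one kernel-verified Lean document; each statement's English description precedes it below -/
import Mathlib

section
/- Let p ≥ 2 be an integer, a = (a₁,…,a_p) ∈ (ℂ∖ℤ)^p with a_i - a_j ∉ ℤ for all i ≠ j, and b = (b₁,…,b_{p-1}) ∈ (ℂ∖ℤ)^{p-1}, with Re(Σ_j b_j - Σ_i a_i) > 0. Then Σ_{k=0}^∞ [Π_i (a_i)_k / (Π_j (b_j)_k · k!)] · [Σ_j ψ(b_j+k) + ψ(1+k) - Σ_i ψ(a_i+k)] = (Π_j Γ(b_j) / Π_i Γ(a_i)) · Σ_{m=1}^{p} [π Γ(a_m) Π_{i≠m} Γ(a_i - a_m) / (sin(π a_m) Π_j Γ(b_j - a_m))] · Σ_{n=0}^∞ [(a_m)_n Π_j (1 - b_j + a_m)_n / (Π_{i≠m} (1 - a_i + a_m)_n · n!)] - (Π_j (1-b_j) / Π_i (1-a_i)) · Σ_{n=0}^∞ [n! Π_j (2-b_j)_n / Π_i (2-a_i)_n]. -/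
open Complex Finset

noncomputable def ψ (z : ℂ) : ℂ := deriv Complex.Gamma z / Complex.Gamma z

noncomputable def rf (x : ℂ) (n : ℕ) : ℂ := ∏ j ∈ Finset.range n, (x + j)

open Filter Topology

theorem rf_zero (x : ℂ) : rf x 0 = 1 := by simp [rf]

theorem rf_add (x : ℂ) (m n : ℕ) : rf x (m + n) = rf x m * rf (x + m) n := by
  simp only [rf, Finset.prod_range_add]
  congr 1
  exact Finset.prod_congr rfl fun j _ => by push_cast; ring

theorem rf_one_right (x : ℂ) : rf x 1 = x := by simp [rf]

theorem rf_succ (x : ℂ) (n : ℕ) : rf x (n + 1) = rf x n * (x + n) := by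
  rw [rf_add, rf_one_right]

theorem rf_one_left (n : ℕ) : rf 1 n = (Nat.factorial n : ℂ) := by
  induction n with
  | zero => simp [rf]
  | succ n ih => rw [rf_succ, ih, Nat.factorial_succ]; push_cast; ring

theorem rf_sub_natCast (x : ℂ) (n : ℕ) : rf (x - n) n = (-1) ^ n * rf (1 - x) n := by
  have hsign : (-1 : ℂ) ^ n = ∏ _j ∈ Finset.range n, (-1 : ℂ) := by simp
  rw [rf, rf, ← Finset.prod_range_reflect, hsign, ← Finset.prod_mul_distrib]
  refine Finset.prod_congr rfl fun j hj => ?_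
  have h : j + 1 ≤ n := Finset.mem_range.mp hj
  rw [Nat.sub_sub, add_comm 1 j, Nat.cast_sub h]
  push_cast
  ring

theorem rf_ne_zero {x : ℂ} (hx : ∀ n : ℕ, x ≠ -n) (n : ℕ) : rf x n ≠ 0 :=
  Finset.prod_ne_zero_iff.mpr fun j _ h => hx j (eq_neg_of_add_eq_zero_left h)

theorem inv_Gamma_eq_rf_mul (x : ℂ) (n : ℕ) :
    (Gamma x)⁻¹ = rf x n * (Gamma (x + n))⁻¹ := by
  induction n with
  | zero => simp [rf]
  | succ n ih =>
    rw [ih, rf_succ, one_div_Gamma_eq_self_mul_one_div_Gamma_add_one (x + n)]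
    push_cast
    ring_nf

theorem Gamma_add_natCast {x : ℂ} (hx : ∀ n : ℕ, x ≠ -n) (n : ℕ) :
    Gamma (x + n) = rf x n * Gamma x := by
  have h := inv_Gamma_eq_rf_mul x n
  have h1 : Gamma x ≠ 0 := Gamma_ne_zero hx
  have h2 : Gamma (x + n) ≠ 0 := Gamma_ne_zero fun m h => hx (n + m) (by
    push_cast; linear_combination h)
  field_simp at h
  linear_combination h

/-- Euler's limit formula for `1 / Γ`, valid at the poles of `Γ` too. -/
theorem tendsto_rf_div (w : ℂ) :
    Tendsto (fun n : ℕ => rf w n / ((n : ℂ) ^ (w - 1) * (Nat.factorial n : ℂ))) atTop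
      (𝓝 (Gamma w)⁻¹) := by
  by_cases hw : ∀ n : ℕ, w ≠ -n
  · have h1 := (GammaSeq_tendsto_Gamma w).inv₀ (Gamma_ne_zero hw)
    have h2 : Tendsto (fun n : ℕ => (n : ℂ) / (n + w)) atTop (𝓝 1) :=
      tendsto_natCast_div_add_atTop w
    have h3 := h1.mul h2
    rw [mul_one] at h3
    refine h3.congr' ?_
    filter_upwards [eventually_ge_atTop 1] with n hn
    have hn0 : (n : ℂ) ≠ 0 := by exact_mod_cast (by omega : n ≠ 0)
    have hwn : (n : ℂ) + w ≠ 0 := fun h => hw n (by linear_combination h)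
    have hf : (Nat.factorial n : ℂ) ≠ 0 := by exact_mod_cast n.factorial_ne_zero
    have hp : (n : ℂ) ^ w ≠ 0 := by simp [cpow_eq_zero_iff, hn0]
    have hG : GammaSeq w n = (n : ℂ) ^ w * (Nat.factorial n : ℂ) / rf w (n + 1) := rfl
    have hr := rf_ne_zero hw n
    rw [hG, rf_succ, cpow_sub _ _ hn0, cpow_one]
    field_simp
    ring
  · push Not at hw
    obtain ⟨q, rfl⟩ := hw
    rw [Gamma_neg_nat_eq_zero, inv_zero]
    refine tendsto_const_nhds.congr' ?_
    filter_upwards [eventually_gt_atTop q] with n hn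
    have : rf (-(q : ℂ)) n = 0 := Finset.prod_eq_zero (Finset.mem_range.mpr hn) (by simp)
    rw [this, zero_div]

section Families

variable {ι κ : Type*} [Fintype ι] [Fintype κ]

theorem prod_cpow_sub_one_mul {c : ℂ} (hc : c ≠ 0) (d : ℂ) (u : ι → ℂ) :
    ∏ i, (c ^ (u i - 1) * d) =
      c ^ (∑ i, u i) * (c ^ Fintype.card ι)⁻¹ * d ^ Fintype.card ι := by
  have h : ∀ i, c ^ (u i - 1) = exp (log c * u i) * c⁻¹ := fun i => by
    rw [cpow_sub _ _ hc, cpow_one, cpow_def_of_ne_zero hc, div_eq_mul_inv]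
  simp only [h]
  rw [Finset.prod_mul_distrib, Finset.prod_mul_distrib, ← exp_sum, ← Finset.mul_sum,
    ← cpow_def_of_ne_zero hc]
  simp

/-- The ratio of products of rising factorials, the general hypergeometric coefficient. -/
noncomputable def rfRatio (x : ι → ℂ) (w : κ → ℂ) (n : ℕ) : ℂ :=
  (∏ j, rf (w j) n) / ∏ i, rf (x i) n

theorem tendsto_cpow_mul_rfRatio (hcard : Fintype.card ι = Fintype.card κ)
    {x : ι → ℂ} {w : κ → ℂ} (hx : ∀ i, ∀ n : ℕ, x i ≠ -n) :
    Tendsto (fun n : ℕ => (n : ℂ) ^ ((∑ i, x i) - ∑ j, w j) * rfRatio x w n) atTop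
      (𝓝 ((∏ i, Gamma (x i)) / ∏ j, Gamma (w j))) := by
  have h1 := (tendsto_finsetProd (s := Finset.univ) fun j _ => tendsto_rf_div (w j)).div
    (tendsto_finsetProd (s := Finset.univ) fun i _ => tendsto_rf_div (x i))
    (Finset.prod_ne_zero_iff.mpr fun i _ => inv_ne_zero (Gamma_ne_zero (hx i)))
  have h2 : (∏ j, (Gamma (w j))⁻¹) / (∏ i, (Gamma (x i))⁻¹) =
      (∏ i, Gamma (x i)) / ∏ j, Gamma (w j) := by
    rw [Finset.prod_inv_distrib, Finset.prod_inv_distrib, div_inv_eq_mul, inv_mul_eq_div]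
  rw [h2] at h1
  refine h1.congr' ?_
  filter_upwards [eventually_ge_atTop 1] with n hn
  have hn0 : (n : ℂ) ≠ 0 := by exact_mod_cast (by omega : n ≠ 0)
  have hf : (Nat.factorial n : ℂ) ≠ 0 := by exact_mod_cast n.factorial_ne_zero
  have hp : ∀ z : ℂ, (n : ℂ) ^ z ≠ 0 := fun z => by simp [cpow_eq_zero_iff, hn0]
  have hP : (∏ i, rf (x i) n) ≠ 0 :=
    Finset.prod_ne_zero_iff.mpr fun i _ => rf_ne_zero (hx i) n
  simp only [Pi.div_apply]
  rw [Finset.prod_div_distrib, Finset.prod_div_distrib,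
    prod_cpow_sub_one_mul hn0, prod_cpow_sub_one_mul hn0, cpow_sub _ _ hn0, hcard,
    rfRatio]
  have := hp (∑ j, w j)
  have := hp (∑ i, x i)
  field_simp

theorem exists_norm_rfRatio_le (hcard : Fintype.card ι = Fintype.card κ)
    {x : ι → ℂ} {w : κ → ℂ} (hx : ∀ i, ∀ n : ℕ, x i ≠ -n) :
    ∃ C : ℝ, 0 ≤ C ∧ ∀ n : ℕ, 1 ≤ n →
      ‖rfRatio x w n‖ ≤ C * (n : ℝ) ^ ((∑ j, w j) - ∑ i, x i).re := by
  obtain ⟨C, hC⟩ := (tendsto_cpow_mul_rfRatio hcard hx (w := w)).norm.bddAbove_range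
  refine ⟨C, (norm_nonneg _).trans (hC ⟨0, rfl⟩), fun n hn => ?_⟩
  have h := hC ⟨n, rfl⟩
  simp only [norm_mul] at h
  rw [norm_natCast_cpow_of_pos hn] at h
  have hn' : (0 : ℝ) < n := by exact_mod_cast hn
  have e : ((∑ j, w j) - ∑ i, x i).re = -((∑ i, x i) - ∑ j, w j).re := by
    simp
  rw [e, Real.rpow_neg hn'.le, ← div_eq_mul_inv, le_div_iff₀ (Real.rpow_pos_of_pos hn' _)]
  linarith

end Families

/-- `rf (y - n) (n + 1 + M)` with the vanishing factor left out when `y = 0`. -/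
theorem prod_ite_shift {y : ℂ} (hy : ∀ k : ℤ, k ≠ 0 → y + k ≠ 0) (n M : ℕ) :
    (∏ l ∈ Finset.range (n + 1 + M), (if y + l - n = 0 then 1 else y + l - n)) =
      (-1) ^ n * rf (1 - y) n * (if y = 0 then 1 else y) * rf (1 + y) M := by
  rw [Finset.prod_range_add, Finset.prod_range_succ, ← rf_sub_natCast]
  congr 1
  · congr 1
    · refine Finset.prod_congr rfl fun l hl => ?_
      have hl' : l < n := Finset.mem_range.mp hl
      have h := hy ((l : ℤ) - n) (by omega)
      push_cast at h
      rw [if_neg (by rwa [add_sub_assoc])]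
      ring
    · simp
  · refine Finset.prod_congr rfl fun l _ => ?_
    have h := hy ((l : ℤ) + 1) (by omega)
    push_cast at h
    have e : y + ((n + 1 + l : ℕ) : ℂ) - n = 1 + y + l := by push_cast; ring
    rw [e, if_neg (fun h' => h (by linear_combination h'))]

theorem rf_sub_natCast_add (z : ℂ) (n M : ℕ) :
    rf (z - n) (n + 1 + M) = (-1) ^ n * rf (1 - z) n * z * rf (1 + z) M := by
  rw [rf_add, rf_succ, rf_sub_natCast]
  congr 2
  · ring
  · push_cast; ring

section PartialFractions

variable {ι κ : Type*} [Fintype ι] [Fintype κ]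

theorem rfRatio_eq_one_add_sum_nodes [DecidableEq ι] (hcard : Fintype.card ι = Fintype.card κ)
    {a : ι → ℂ} (c : κ → ℂ) (hab : ∀ i j, i ≠ j → ∀ n : ℤ, a i - a j ≠ n)
    {s : ℂ} (hs : ∀ i, ∀ n : ℕ, a i + s ≠ -n) (N : ℕ) :
    rfRatio (fun i => a i + s) (fun j => c j + s) N =
      1 + ∑ m, ∑ n ∈ Finset.range N,
        (∏ j, rf (c j - a m - n) N) /
          (∏ i, ∏ l ∈ Finset.range N,
            if a i - a m + l - n = 0 then 1 else a i - a m + l - n) / (s + a m + n) := by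
  classical
  let S : Finset (ι × ℕ) := Finset.univ ×ˢ Finset.range N
  let v : ι × ℕ → ℂ := fun q => -(a q.1 + q.2)
  let T : Finset (κ × ℕ) := Finset.univ ×ˢ Finset.range N
  let u : κ × ℕ → ℂ := fun q => -(c q.1 + q.2)
  have hzero : ∀ i m : ι, ∀ l n : ℕ, a i - a m + l - n = 0 ↔ (i, l) = (m, n) := by
    intro i m l n
    constructor
    · intro h
      by_cases him : i = m
      · subst him
        have h' : (l : ℂ) = n := by linear_combination h
        rw [Nat.cast_injective h']
      · exact absurd (by push_cast; linear_combination h) (hab i m him (n - l))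
    · intro h
      obtain ⟨rfl, rfl⟩ := Prod.mk.inj h
      ring
  have hv : Set.InjOn v S := by
    rintro ⟨i, l⟩ - ⟨m, n⟩ - h
    exact (hzero i m l n).mp (by simp only [v] at h; linear_combination -h)
  have hsv : ∀ q ∈ S, s ≠ v q := fun q _ h => hs q.1 q.2 (by
    simp only [v] at h; linear_combination h)
  have hST : S.card = T.card := by simp [S, T, hcard]
  have hdeg : (Lagrange.nodal T u - Lagrange.nodal S v).degree < S.card := by
    have := Polynomial.degree_sub_lt_right (p := Lagrange.nodal T u) (q := Lagrange.nodal S v)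
      (by rw [Lagrange.degree_nodal, Lagrange.degree_nodal, hST]) Lagrange.nodal_ne_zero
      (by rw [Lagrange.nodal_monic.leadingCoeff, Lagrange.nodal_monic.leadingCoeff])
    rwa [Lagrange.degree_nodal] at this
  have hint := Lagrange.eq_interpolate_of_eval_eq (r := fun q => (Lagrange.nodal T u).eval (v q))
    hv hdeg (fun q hq => by
      rw [Polynomial.eval_sub, Lagrange.eval_nodal_at_node hq, sub_zero])
  have hev := congrArg (Polynomial.eval s) hint
  rw [Lagrange.eval_interpolate_not_at_node _ hsv, Polynomial.eval_sub] at hev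
  have hT : ∀ t : ℂ, (Lagrange.nodal T u).eval t = ∏ j, rf (c j + t) N := by
    intro t
    rw [Lagrange.eval_nodal, Finset.prod_product]
    refine Finset.prod_congr rfl fun j _ => Finset.prod_congr rfl fun l _ => ?_
    simp only [u]; ring
  have hS : (Lagrange.nodal S v).eval s = ∏ i, rf (a i + s) N := by
    rw [Lagrange.eval_nodal, Finset.prod_product]
    refine Finset.prod_congr rfl fun j _ => Finset.prod_congr rfl fun l _ => ?_
    simp only [v]; ring
  have hne : (∏ i, rf (a i + s) N) ≠ 0 :=
    Finset.prod_ne_zero_iff.mpr fun i _ => rf_ne_zero (hs i) N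
  rw [hS, sub_eq_iff_eq_add] at hev
  have hnum : (∏ j, rf (c j + s) N) = (∏ i, rf (a i + s) N) *
      (1 + ∑ q ∈ S, Lagrange.nodalWeight S v q * (s - v q)⁻¹ * (Lagrange.nodal T u).eval (v q)) := by
    rw [← hT, hev]; ring
  rw [rfRatio, hnum, mul_div_cancel_left₀ _ hne, Finset.sum_product]
  congr 1
  refine Finset.sum_congr rfl fun m _ => Finset.sum_congr rfl fun n hn => ?_
  have hw : Lagrange.nodalWeight S v (m, n) = (∏ i, ∏ l ∈ Finset.range N,
      if a i - a m + l - n = 0 then 1 else a i - a m + l - n)⁻¹ := by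
    have hmem : (m, n) ∈ S := by simpa [S] using hn
    rw [Lagrange.nodalWeight, Finset.prod_inv_distrib,
      ← Finset.prod_product' (f := fun i (l : ℕ) =>
        if a i - a m + l - n = 0 then 1 else a i - a m + l - n),
      ← Finset.mul_prod_erase _ _ hmem]
    rw [if_pos ((hzero _ _ _ _).mpr rfl), one_mul]
    congr 1
    refine Finset.prod_congr rfl fun q hq => ?_
    rw [if_neg (fun h => (Finset.mem_erase.mp hq).1 ((hzero _ _ _ _).mp h))]
    simp only [v]; ring
  rw [hw, hT]
  have e1 : s - v (m, n) = s + a m + n := by simp only [v]; ring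
  have e2 : ∀ j, c j + v (m, n) = c j - a m - n := fun j => by simp only [v]; ring
  simp only [e1, e2]
  field_simp

theorem rfRatio_eq_one_add_sum [DecidableEq ι] (hcard : Fintype.card ι = Fintype.card κ)
    {a : ι → ℂ} (c : κ → ℂ) (hab : ∀ i j, i ≠ j → ∀ n : ℤ, a i - a j ≠ n)
    {s : ℂ} (hs : ∀ i, ∀ n : ℕ, a i + s ≠ -n) (N : ℕ) :
    rfRatio (fun i => a i + s) (fun j => c j + s) N =
      1 + ∑ m, ∑ n ∈ Finset.range N,
        (∏ j, (c j - a m)) / (∏ i ∈ Finset.univ.erase m, (a i - a m)) *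
          rfRatio (fun i => 1 - (a i - a m)) (fun j => 1 - (c j - a m)) n *
          rfRatio (fun i => 1 + (a i - a m)) (fun j => 1 + (c j - a m)) (N - 1 - n) /
            (s + a m + n) := by
  rw [rfRatio_eq_one_add_sum_nodes hcard c hab hs]
  congr 1
  refine Finset.sum_congr rfl fun m _ => Finset.sum_congr rfl fun n hn => ?_
  congr 1
  obtain ⟨M, rfl⟩ : ∃ M, N = n + 1 + M := ⟨N - (n + 1), by
    have := Finset.mem_range.mp hn; omega⟩
  have hM : n + 1 + M - 1 - n = M := by omega
  have hy : ∀ i, ∀ k : ℤ, k ≠ 0 → a i - a m + k ≠ 0 := by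
    intro i k hk h
    by_cases him : i = m
    · subst him
      simp [hk] at h
    · exact hab i m him (-k) (by push_cast; linear_combination h)
  have hD : (∏ i, if a i - a m = 0 then 1 else a i - a m) =
      ∏ i ∈ Finset.univ.erase m, (a i - a m) := by
    rw [← Finset.mul_prod_erase _ _ (Finset.mem_univ m), if_pos (sub_self _), one_mul]
    refine Finset.prod_congr rfl fun i hi => ?_
    rw [if_neg]
    simpa using hab i m (Finset.ne_of_mem_erase hi) 0
  simp only [prod_ite_shift (hy _), rf_sub_natCast_add, hM, Finset.prod_mul_distrib, hD, rfRatio,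
    Finset.prod_const, Finset.card_univ, hcard]
  have : ((-1 : ℂ) ^ n) ^ Fintype.card κ ≠ 0 := by simp
  rw [mul_assoc, mul_assoc, mul_assoc, mul_assoc, mul_div_mul_left _ _ this]
  simp only [div_mul_div_comm]
  congr 1 <;> ring

end PartialFractions

theorem exists_pos_le_norm_add_intCast {z : ℂ} (hz : ∀ k : ℤ, z ≠ k) :
    ∃ d : ℝ, 0 < d ∧ ∀ k : ℤ, d ≤ ‖z + k‖ := by
  have hmem : z ∈ (Set.range ((↑) : ℤ → ℂ))ᶜ := by
    rintro ⟨k, hk⟩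
    exact hz k hk.symm
  obtain ⟨d, hd, hball⟩ := Metric.isOpen_iff.mp Complex.isOpen_compl_range_intCast z hmem
  refine ⟨d, hd, fun k => not_lt.mp fun h => ?_⟩
  refine hball (show ((-k : ℤ) : ℂ) ∈ Metric.ball z d from ?_) ⟨-k, rfl⟩
  rw [Metric.mem_ball, dist_comm, dist_eq_norm]
  simpa using h

theorem tendsto_natCast_add_cpow_div_cpow (e : ℂ) (k : ℕ) :
    Tendsto (fun n : ℕ => ((n + k : ℕ) : ℂ) ^ e / (n : ℂ) ^ e) atTop (𝓝 1) := by
  have h1 : Tendsto (fun n : ℕ => (((n : ℝ) / (n + k) : ℝ) : ℂ)) atTop (𝓝 1) := by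
    have h := tendsto_natCast_div_add_atTop (𝕜 := ℝ) (k : ℝ)
    exact_mod_cast (Complex.continuous_ofReal.tendsto (1 : ℝ)).comp h
  have h2 : Tendsto (fun n : ℕ => (((n : ℝ) / (n + k) : ℝ) : ℂ) ^ e) atTop (𝓝 ((1 : ℂ) ^ e)) :=
    h1.cpow tendsto_const_nhds (by simp)
  rw [one_cpow] at h2
  have h3 := h2.inv₀ one_ne_zero
  rw [inv_one] at h3
  refine h3.congr' ?_
  filter_upwards [eventually_ge_atTop 1] with n hn
  have hn0 : (0 : ℝ) < n := by exact_mod_cast hn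
  have hnk : (0 : ℝ) < (n : ℝ) + k := by positivity
  have hc : ((n + k : ℕ) : ℂ) ^ e ≠ 0 := by
    rw [Ne, cpow_eq_zero_iff]
    push Not
    intro h
    exact absurd h (by exact_mod_cast (by omega : n + k ≠ 0))
  have key : (((n : ℝ) / (n + k) : ℝ) : ℂ) ^ e * (((n : ℝ) + k : ℝ) : ℂ) ^ e =
      ((n : ℝ) : ℂ) ^ e := by
    rw [← mul_cpow_ofReal_nonneg (by positivity) hnk.le, ← ofReal_mul,
      div_mul_cancel₀ _ hnk.ne']
  have e1 : (((n : ℝ) + k : ℝ) : ℂ) = ((n + k : ℕ) : ℂ) := by push_cast; rfl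
  rw [e1] at key
  rw [eq_div_of_mul_eq hc key, inv_div, ofReal_natCast]

section GammaRatio

variable {ι κ : Type*} [Fintype ι] [Fintype κ]

theorem sum_const_sub_sub (hcard : Fintype.card ι = Fintype.card κ) (x : ι → ℂ) (w : κ → ℂ)
    (t r : ℂ) :
    (∑ j, (t - (w j - r))) - ∑ i, (t - (x i - r)) = (∑ i, x i) - ∑ j, w j := by
  simp [Finset.sum_sub_distrib, hcard]

theorem sum_const_add_sub (hcard : Fintype.card ι = Fintype.card κ) (x : ι → ℂ) (w : κ → ℂ)
    (t r : ℂ) :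
    (∑ j, (t + (w j - r))) - ∑ i, (t + (x i - r)) = (∑ j, w j) - ∑ i, x i := by
  simp [Finset.sum_sub_distrib, Finset.sum_add_distrib, hcard]

theorem summable_rfRatio (hcard : Fintype.card ι = Fintype.card κ)
    {x : ι → ℂ} {w : κ → ℂ} (hx : ∀ i, ∀ n : ℕ, x i ≠ -n)
    (h : ((∑ j, w j) - ∑ i, x i).re < -1) : Summable (rfRatio x w) := by
  obtain ⟨C, -, hC⟩ := exists_norm_rfRatio_le hcard hx (w := w)
  refine Summable.of_norm_bounded_eventually_nat ((Real.summable_nat_rpow.mpr h).mul_left C) ?_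
  filter_upwards [eventually_ge_atTop 1] with n hn using hC n hn

theorem exists_norm_cpow_mul_rfRatio_le (hcard : Fintype.card ι = Fintype.card κ)
    {x : ι → ℂ} {w : κ → ℂ} (hx : ∀ i, ∀ n : ℕ, x i ≠ -n)
    (h : 0 ≤ ((∑ j, w j) - ∑ i, x i).re) :
    ∃ C : ℝ, 0 ≤ C ∧ ∀ M N : ℕ, M < N →
      ‖(N : ℂ) ^ ((∑ i, x i) - ∑ j, w j) * rfRatio x w M‖ ≤ C := by
  obtain ⟨C, hC0, hC⟩ := exists_norm_rfRatio_le hcard hx (w := w)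
  refine ⟨C + 1, by positivity, fun M N hMN => ?_⟩
  have hN : 0 < N := by omega
  have hN1 : (1 : ℝ) ≤ N := by exact_mod_cast hN
  have hN' : (0 : ℝ) < N := by exact_mod_cast hN
  set e := ((∑ j, w j) - ∑ i, x i).re with he
  have e1 : ((∑ i, x i) - ∑ j, w j).re = -e := by simp [he]
  have hpos : 0 < (N : ℝ) ^ e := Real.rpow_pos_of_pos hN' _
  rw [norm_mul, norm_natCast_cpow_of_pos hN, e1, Real.rpow_neg hN'.le, inv_mul_le_iff₀ hpos]
  rcases Nat.eq_zero_or_pos M with rfl | hM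
  · have : rfRatio x w 0 = 1 := by simp [rfRatio, rf_zero]
    rw [this, norm_one]
    have := Real.one_le_rpow hN1 h
    nlinarith
  · have h1 := hC M hM
    have h2 : (M : ℝ) ^ e ≤ (N : ℝ) ^ e :=
      Real.rpow_le_rpow (Nat.cast_nonneg _) (by exact_mod_cast hMN.le) h
    nlinarith [mul_le_mul_of_nonneg_left h2 hC0]

theorem tendsto_cpow_mul_rfRatio_sub (hcard : Fintype.card ι = Fintype.card κ)
    {x : ι → ℂ} {w : κ → ℂ} (hx : ∀ i, ∀ n : ℕ, x i ≠ -n) (n : ℕ) :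
    Tendsto (fun N : ℕ => (N : ℂ) ^ ((∑ i, x i) - ∑ j, w j) * rfRatio x w (N - 1 - n)) atTop
      (𝓝 ((∏ i, Gamma (x i)) / ∏ j, Gamma (w j))) := by
  rw [← tendsto_add_atTop_iff_nat (n + 1)]
  have h := (tendsto_natCast_add_cpow_div_cpow ((∑ i, x i) - ∑ j, w j) (n + 1)).mul
    (tendsto_cpow_mul_rfRatio hcard hx (w := w))
  rw [one_mul] at h
  refine h.congr' ?_
  filter_upwards [eventually_ge_atTop 1] with M hM
  have hM0 : (M : ℂ) ^ ((∑ i, x i) - ∑ j, w j) ≠ 0 := by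
    rw [Ne, cpow_eq_zero_iff]
    push Not
    intro h
    exact absurd h (by exact_mod_cast (by omega : M ≠ 0))
  have e : M + (n + 1) - 1 - n = M := by omega
  rw [e, ← mul_assoc, div_mul_cancel₀ _ hM0]

variable [DecidableEq ι]

theorem prod_div_mul_prod_Gamma_one_add (a : ι → ℂ) (c : κ → ℂ)
    (hab : ∀ i j, i ≠ j → ∀ n : ℤ, a i - a j ≠ n) (m : ι) :
    (∏ j, (c j - a m)) / (∏ i ∈ Finset.univ.erase m, (a i - a m)) *
        ((∏ i, Gamma (1 + (a i - a m))) / ∏ j, Gamma (1 + (c j - a m))) =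
      (∏ i ∈ Finset.univ.erase m, Gamma (a i - a m)) / ∏ j, Gamma (c j - a m) := by
  have h0 : ∀ i ∈ Finset.univ.erase m, a i - a m ≠ 0 := fun i hi => by
    simpa using hab i m (Finset.ne_of_mem_erase hi) 0
  have h1 : ∏ i, Gamma (1 + (a i - a m)) =
      (∏ i ∈ Finset.univ.erase m, (a i - a m)) * ∏ i ∈ Finset.univ.erase m, Gamma (a i - a m) := by
    rw [← Finset.mul_prod_erase _ _ (Finset.mem_univ m), sub_self, add_zero, Gamma_one, one_mul,
      ← Finset.prod_mul_distrib]
    exact Finset.prod_congr rfl fun i hi => by rw [add_comm, Gamma_add_one _ (h0 i hi)]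
  have h2 : (∏ j, Gamma (c j - a m))⁻¹ =
      (∏ j, (c j - a m)) * (∏ j, Gamma (1 + (c j - a m)))⁻¹ := by
    rw [← Finset.prod_inv_distrib, ← Finset.prod_inv_distrib, ← Finset.prod_mul_distrib]
    exact Finset.prod_congr rfl fun j _ => by
      rw [add_comm, ← one_div_Gamma_eq_self_mul_one_div_Gamma_add_one]
  have h3 := Finset.prod_ne_zero_iff.mpr h0
  rw [div_eq_mul_inv _ (∏ j, Gamma (c j - a m)), h2, h1]
  field_simp

/-- Partial fraction expansion of a balanced ratio of Gamma functions. -/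
theorem prod_Gamma_div_prod_Gamma_eq_sum (hcard : Fintype.card ι = Fintype.card κ)
    {a : ι → ℂ} {c : κ → ℂ} (hab : ∀ i j, i ≠ j → ∀ n : ℤ, a i - a j ≠ n)
    (hre : 1 < ((∑ j, c j) - ∑ i, a i).re)
    {s : ℂ} (hs : ∀ i, ∀ n : ℤ, s + a i ≠ n) :
    (∏ i, Gamma (a i + s)) / ∏ j, Gamma (c j + s) =
      ∑ m, (∏ i ∈ Finset.univ.erase m, Gamma (a i - a m)) / (∏ j, Gamma (c j - a m)) *
        ∑' n : ℕ, rfRatio (fun i => 1 - (a i - a m)) (fun j => 1 - (c j - a m)) n /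
          (s + a m + n) := by
  have hs' : ∀ i, ∀ n : ℕ, a i + s ≠ -n := fun i n h =>
    hs i (-n) (by push_cast; linear_combination h)
  have hP : ∀ m i, ∀ n : ℕ, 1 - (a i - a m) ≠ -n := by
    intro m i n h
    by_cases him : i = m
    · subst him
      exact absurd (show ((n + 1 : ℕ) : ℂ) = 0 by push_cast; linear_combination h)
        (by exact_mod_cast n.succ_ne_zero)
    · exact hab i m him (n + 1) (by push_cast; linear_combination -h)
  have hQ : ∀ m i, ∀ n : ℕ, 1 + (a i - a m) ≠ -n := by
    intro m i n h
    by_cases him : i = m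
    · subst him
      exact absurd (show ((n + 1 : ℕ) : ℂ) = 0 by push_cast; linear_combination h)
        (by exact_mod_cast n.succ_ne_zero)
    · exact hab i m him (-(n + 1)) (by push_cast; linear_combination h)
  have hK : ∀ m, (∑ i, (1 + (a i - a m))) - ∑ j, (1 + (c j - a m)) = (∑ i, a i) - ∑ j, c j :=
    fun m => sum_const_add_sub hcard.symm c a 1 (a m)
  have hL : (∑ i, (a i + s)) - ∑ j, (c j + s) = (∑ i, a i) - ∑ j, c j := by
    simp [Finset.sum_add_distrib, hcard]
  have lim1 := tendsto_cpow_mul_rfRatio hcard hs' (w := fun j => c j + s)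
  rw [hL] at lim1
  have lim0 : Tendsto (fun N : ℕ => (N : ℂ) ^ ((∑ i, a i) - ∑ j, c j)) atTop (𝓝 0) := by
    rw [tendsto_zero_iff_norm_tendsto_zero]
    have h := (tendsto_rpow_neg_atTop (zero_lt_one.trans hre)).comp
      (tendsto_natCast_atTop_atTop (R := ℝ))
    refine h.congr' ?_
    filter_upwards [eventually_gt_atTop 0] with N hN
    rw [norm_natCast_cpow_of_pos hN]
    simp
  have limm : ∀ m, Tendsto (fun N : ℕ => ∑ n ∈ Finset.range N,
      (N : ℂ) ^ ((∑ i, a i) - ∑ j, c j) * ((∏ j, (c j - a m)) / (∏ i ∈ Finset.univ.erase m, (a i - a m)) *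
          rfRatio (fun i => 1 - (a i - a m)) (fun j => 1 - (c j - a m)) n *
          rfRatio (fun i => 1 + (a i - a m)) (fun j => 1 + (c j - a m)) (N - 1 - n) /
            (s + a m + n))) atTop
      (𝓝 ((∏ i ∈ Finset.univ.erase m, Gamma (a i - a m)) / (∏ j, Gamma (c j - a m)) *
        ∑' n : ℕ, rfRatio (fun i => 1 - (a i - a m)) (fun j => 1 - (c j - a m)) n /
          (s + a m + n))) := by
    intro m
    set P := rfRatio (fun i => 1 - (a i - a m)) (fun j => 1 - (c j - a m)) with hPdef
    set Q := rfRatio (fun i => 1 + (a i - a m)) (fun j => 1 + (c j - a m)) with hQdef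
    set D := (∏ j, (c j - a m)) / (∏ i ∈ Finset.univ.erase m, (a i - a m)) with hD
    set e := (∑ i, a i) - ∑ j, c j with he
    have hPs : Summable P := summable_rfRatio hcard (hP m) (by
      rw [sum_const_sub_sub hcard]
      simp only [sub_re] at hre ⊢
      linarith)
    obtain ⟨C, hC0, hC⟩ := exists_norm_cpow_mul_rfRatio_le hcard (hQ m)
      (w := fun j => 1 + (c j - a m)) (by rw [sum_const_add_sub hcard]; linarith)
    have hlimQ := tendsto_cpow_mul_rfRatio_sub hcard (hQ m) (w := fun j => 1 + (c j - a m))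
    rw [hK] at hC hlimQ
    obtain ⟨d, hd, hdn⟩ := exists_pos_le_norm_add_intCast (hs m)
    have hsum : ∀ N : ℕ, ∑ n ∈ Finset.range N,
        (N : ℂ) ^ e * (D * P n * Q (N - 1 - n) / (s + a m + n)) =
        ∑' n : ℕ, if n < N then (N : ℂ) ^ e * (D * P n * Q (N - 1 - n) / (s + a m + n)) else 0 := by
      intro N
      rw [tsum_eq_sum (s := Finset.range N) (fun n hn => if_neg (by simpa using hn))]
      exact Finset.sum_congr rfl fun n hn => (if_pos (Finset.mem_range.mp hn)).symm
    simp only [hsum]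
    rw [← prod_div_mul_prod_Gamma_one_add a c hab m, ← hD, ← tsum_mul_left]
    refine tendsto_tsum_of_dominated_convergence
      (bound := fun n => ‖D‖ * C / d * ‖P n‖) (hPs.norm.mul_left _) (fun n => ?_)
      (Eventually.of_forall fun N n => ?_)
    · have h := ((hlimQ n).const_mul (D * P n / (s + a m + n)))
      have e2 : D * ((∏ i, Gamma (1 + (a i - a m))) / ∏ j, Gamma (1 + (c j - a m))) *
          (P n / (s + a m + n)) = D * P n / (s + a m + n) *
          ((∏ i, Gamma (1 + (a i - a m))) / ∏ j, Gamma (1 + (c j - a m))) := by ring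
      rw [e2]
      refine h.congr' ?_
      filter_upwards [eventually_gt_atTop n] with N hN
      rw [if_pos hN]
      ring
    · split_ifs with hn
      · have h1 := hC (N - 1 - n) N (by omega)
        have h2 := hdn n
        rw [Int.cast_natCast] at h2
        have e2 : (N : ℂ) ^ e * (D * P n * Q (N - 1 - n) / (s + a m + n)) =
          D * ((N : ℂ) ^ e * Q (N - 1 - n)) / (s + a m + n) * P n := by ring
        rw [e2, norm_mul, norm_div, norm_mul]
        gcongr
      · rw [norm_zero]; positivity
  have lim2 := lim0.add (tendsto_finsetSum Finset.univ fun m _ => limm m)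
  rw [zero_add] at lim2
  refine tendsto_nhds_unique lim1 (lim2.congr fun N => ?_)
  rw [rfRatio_eq_one_add_sum hcard c hab hs', mul_add, mul_one, Finset.mul_sum]
  simp only [Finset.mul_sum]

end GammaRatio

theorem norm_add_intCast_half_le {z w : ℂ} {d : ℝ} (hd : ∀ k : ℤ, d ≤ ‖z + k‖)
    (hw : ‖w - z‖ < d / 2) (k : ℤ) : ‖z + k‖ / 2 ≤ ‖w + k‖ := by
  have h1 : ‖z + k‖ ≤ ‖w + k‖ + ‖w - z‖ := by
    have : z + k = (w + k) - (w - z) := by ring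
    rw [this]
    exact norm_sub_le _ _
  linarith [hd k]

theorem summable_inv_add_intCast_sq (x : ℂ) : Summable fun k : ℤ => ((x + k) ^ 2)⁻¹ := by
  have := EisensteinSeries.linear_right_summable x 1 (k := 2) (by norm_num)
  refine this.congr fun k => ?_
  simp

theorem hasSum_inv_add_intCast_sq {x : ℂ} (hx : ∀ k : ℤ, x ≠ k) :
    HasSum (fun k : ℤ => ((x + k) ^ 2)⁻¹)
      ((Real.pi : ℂ) ^ 2 / sin ((Real.pi : ℂ) * x) ^ 2) := by
  have hmem : x ∈ Complex.integerComplement := by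
    rintro ⟨k, hk⟩
    exact hx k hk.symm
  obtain ⟨d, hd, hdn⟩ := exists_pos_le_norm_add_intCast hx
  have hball : ∀ w ∈ Metric.ball x (d / 2), ∀ k : ℤ, ‖x + k‖ / 2 ≤ ‖w + k‖ := fun w hw =>
    norm_add_intCast_half_le hdn (by simpa [dist_eq_norm] using hw)
  have hne : ∀ w ∈ Metric.ball x (d / 2), ∀ k : ℤ, w + k ≠ 0 := fun w hw k h => by
    have h1 := hball w hw k
    rw [h, norm_zero] at h1
    linarith [hdn k]
  have hcompl : ∀ w ∈ Metric.ball x (d / 2), w ∈ Complex.integerComplement := by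
    rintro w hw ⟨k, rfl⟩
    exact hne _ hw (-k) (by push_cast; ring)
  have hsn : ∀ w ∈ Metric.ball x (d / 2), ∀ n : ℕ, w - (n + 1) ≠ 0 ∧ w + (n + 1) ≠ 0 :=
    fun w hw n => by
      have h1 := hne w hw (-(n + 1))
      have h2 := hne w hw (n + 1)
      push_cast at h1 h2
      exact ⟨by rwa [sub_eq_add_neg], h2⟩
  have hx0 : x ∈ Metric.ball x (d / 2) := Metric.mem_ball_self (by positivity)
  have hxne : x ≠ 0 := by simpa using hx 0
  let f : ℕ → ℂ → ℂ := fun n w => 1 / (w - (n + 1)) + 1 / (w + (n + 1))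
  have hf : ∀ n, ∀ w ∈ Metric.ball x (d / 2),
      f n w = 2 * w * ((w + (n + 1)) * (w - (n + 1)))⁻¹ := fun n w hw => by
    obtain ⟨h1, h2⟩ := hsn w hw n
    simp only [f]
    field_simp
    ring
  have hder : HasSum (fun n => deriv (f n) x) (deriv (fun w => ∑' n, f n w) x) := by
    refine hasSum_deriv_of_summable_norm (U := Metric.ball x (d / 2))
      (u := fun n => 4 * (‖x‖ + d / 2) / ‖x‖ * ‖f n x‖)
      ((summable_cotTerm hmem).norm.mul_left _) (fun n w hw => ?_) Metric.isOpen_ball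
      (fun n w hw => ?_) hx0
    · obtain ⟨h1, h2⟩ := hsn w hw n
      have h3 : DifferentiableAt ℂ (fun w : ℂ => 1 / (w - (n + 1))) w := by
        fun_prop (disch := assumption)
      have h4 : DifferentiableAt ℂ (fun w : ℂ => 1 / (w + (n + 1))) w := by
        fun_prop (disch := assumption)
      exact (h3.add h4).differentiableWithinAt
    · obtain ⟨h1, h2⟩ := hsn x hx0 n
      have hb1 := hball w hw (-(n + 1))
      have hb2 := hball w hw (n + 1)
      push_cast at hb1 hb2
      rw [← sub_eq_add_neg, ← sub_eq_add_neg] at hb1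
      have hw1 : ‖w‖ ≤ ‖x‖ + d / 2 := by
        have : w = x + (w - x) := by ring
        rw [this]
        have h3 : ‖w - x‖ < d / 2 := by simpa [dist_eq_norm] using hw
        linarith [norm_add_le x (w - x)]
      have hp1 : 0 < ‖x - (n + 1)‖ := norm_pos_iff.mpr h1
      have hp2 : 0 < ‖x + (n + 1)‖ := norm_pos_iff.mpr h2
      have hpx : 0 < ‖x‖ := norm_pos_iff.mpr hxne
      rw [hf n w hw, hf n x hx0]
      simp only [norm_mul, norm_inv]
      have e : 4 * (‖x‖ + d / 2) / ‖x‖ *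
          (‖(2 : ℂ)‖ * ‖x‖ * (‖x + (n + 1)‖ * ‖x - (n + 1)‖)⁻¹) =
          ‖(2 : ℂ)‖ * (‖x‖ + d / 2) * (‖x + (n + 1)‖ / 2 * (‖x - (n + 1)‖ / 2))⁻¹ := by
        field_simp
        ring
      rw [e]
      gcongr
  have hd1 : ∀ n, deriv (f n) x = -(((x + (n + 1)) ^ 2)⁻¹ + ((x - (n + 1)) ^ 2)⁻¹) := by
    intro n
    obtain ⟨h1, h2⟩ := hsn x hx0 n
    have := (((hasDerivAt_id x).sub_const ((n : ℂ) + 1)).fun_inv h1).add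
      (((hasDerivAt_id x).add_const ((n : ℂ) + 1)).fun_inv h2)
    have e : f n = (fun w => (id w - ((n : ℂ) + 1))⁻¹) + fun w => (id w + ((n : ℂ) + 1))⁻¹ := by
      ext w; simp [f]
    rw [e, this.deriv]
    simp only [id]
    ring
  have hsin := sin_pi_mul_ne_zero hmem
  have hd2 : deriv (fun w => ∑' n, f n w) x =
      -((Real.pi : ℂ) ^ 2 / sin ((Real.pi : ℂ) * x) ^ 2) + (x ^ 2)⁻¹ := by
    have he : (fun w => ∑' n, f n w) =ᶠ[𝓝 x]
        fun w => (Real.pi : ℂ) * (cos (Real.pi * w) / sin (Real.pi * w)) - w⁻¹ := by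
      filter_upwards [Metric.ball_mem_nhds x (by positivity : 0 < d / 2)] with w hw
      have := cot_series_rep' (hcompl w hw)
      rw [Complex.cot, one_div] at this
      exact this.symm
    rw [he.deriv_eq]
    have hl : HasDerivAt (fun w : ℂ => (Real.pi : ℂ) * w) (Real.pi : ℂ) x := by
      simpa using (hasDerivAt_id x).const_mul (Real.pi : ℂ)
    have := ((hl.ccos.fun_div hl.csin hsin).const_mul (Real.pi : ℂ)).fun_sub (hasDerivAt_inv hxne)
    rw [this.deriv]
    have hcs := sin_sq_add_cos_sq ((Real.pi : ℂ) * x)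
    field_simp
    linear_combination (-(Real.pi : ℂ) ^ 2 * x ^ 2) * hcs
  obtain ⟨S, hS⟩ := summable_inv_add_intCast_sq x
  have h1 := hS.nat_add_neg
  rw [← hasSum_nat_add_iff' 1] at h1
  rw [hd2] at hder
  simp only [hd1] at hder
  have h2 := hder.neg
  have hfun : (fun n : ℕ => -(-(((x + (n + 1)) ^ 2)⁻¹ + ((x - (n + 1)) ^ 2)⁻¹))) =
      fun n : ℕ => ((x + ((n + 1 : ℕ) : ℤ)) ^ 2)⁻¹ + ((x + ((-((n + 1 : ℕ) : ℤ) : ℤ))) ^ 2)⁻¹ := by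
    ext n
    push_cast
    rw [neg_neg, sub_eq_add_neg]
  rw [hfun] at h2
  have h3 := h1.unique h2
  have h4 : S = (Real.pi : ℂ) ^ 2 / sin ((Real.pi : ℂ) * x) ^ 2 := by
    simp at h3
    linear_combination h3
  rwa [← h4]

theorem hasDerivAt_tsum_div {P : ℕ → ℂ} (hP : Summable P) {x : ℂ} (hx : ∀ k : ℤ, x ≠ k) (k : ℤ) :
    HasDerivAt (fun s : ℂ => ∑' n : ℕ, P n / (s + x + n))
      (-∑' n : ℕ, P n * ((x + ((k + n : ℤ) : ℂ)) ^ 2)⁻¹) k := by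
  obtain ⟨d, hd, hdn⟩ := exists_pos_le_norm_add_intCast hx
  have hlow : ∀ n : ℕ, ∀ w ∈ Metric.ball (k : ℂ) (d / 2), d / 2 ≤ ‖w + x + n‖ := by
    intro n w hw
    have h1 := norm_add_intCast_half_le (z := x) (w := w - k + x) hdn
      (by simpa [dist_eq_norm] using hw) (k + n)
    have h2 := hdn (k + n)
    have e : w - k + x + ((k + n : ℤ) : ℂ) = w + x + n := by push_cast; ring
    rw [e] at h1
    linarith
  have hne : ∀ n : ℕ, ∀ w ∈ Metric.ball (k : ℂ) (d / 2), w + x + n ≠ 0 := fun n w hw h => by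
    have := hlow n w hw
    rw [h, norm_zero] at this
    linarith
  have hu : Summable fun n => ‖P n‖ / (d / 2) := hP.norm.div_const _
  have hf : ∀ n : ℕ, DifferentiableOn ℂ (fun s : ℂ => P n / (s + x + n))
      (Metric.ball (k : ℂ) (d / 2)) := fun n w hw => by
    have h := hne n w hw
    have : DifferentiableAt ℂ (fun s : ℂ => P n / (s + x + n)) w := by
      fun_prop (disch := assumption)
    exact this.differentiableWithinAt
  have hb : ∀ (n : ℕ) (w : ℂ), w ∈ Metric.ball (k : ℂ) (d / 2) →
      ‖P n / (w + x + n)‖ ≤ ‖P n‖ / (d / 2) := fun n w hw => by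
    rw [norm_div]
    have := hlow n w hw
    gcongr
  have hk : (k : ℂ) ∈ Metric.ball (k : ℂ) (d / 2) := Metric.mem_ball_self (by positivity)
  have h1 := hasSum_deriv_of_summable_norm hu hf Metric.isOpen_ball hb hk
  have h2 := (differentiableOn_tsum_of_summable_norm hu hf Metric.isOpen_ball hb).differentiableAt
    (Metric.isOpen_ball.mem_nhds hk)
  have h3 := h2.hasDerivAt
  rw [← h1.tsum_eq] at h3
  refine h3.congr_deriv ?_
  rw [← tsum_neg]
  refine tsum_congr fun n => ?_
  have h4 : HasDerivAt (fun s : ℂ => s + x + n) 1 k :=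
    ((hasDerivAt_id (k : ℂ)).add_const x).add_const (n : ℂ)
  have h5 := (h4.fun_inv (hne n k hk)).const_mul (P n)
  simp only [div_eq_mul_inv]
  rw [h5.deriv]
  have e : x + ((k + n : ℤ) : ℂ) = (k : ℂ) + x + n := by push_cast; ring
  rw [e]
  ring

theorem HasSum.comp_int_add_nat {f : ℤ × ℕ → ℂ} {S : ℂ} (hf : HasSum f S) :
    HasSum (fun q : ℤ × ℕ => f (q.1 + (q.2 : ℤ), q.2)) S := by
  let e : ℤ × ℕ ≃ ℤ × ℕ :=
    { toFun := fun q => (q.1 + (q.2 : ℤ), q.2)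
      invFun := fun q => (q.1 - (q.2 : ℤ), q.2)
      left_inv := fun q => Prod.ext (add_sub_cancel_right _ _) rfl
      right_inv := fun q => Prod.ext (sub_add_cancel _ _) rfl }
  exact e.hasSum_iff.mpr hf

theorem hasSum_tsum_mul_inv_sq {P : ℕ → ℂ} (hP : Summable P) {x : ℂ} (hx : ∀ k : ℤ, x ≠ k) :
    HasSum (fun k : ℤ => ∑' n : ℕ, P n * ((x + ((k + n : ℤ) : ℂ)) ^ 2)⁻¹)
      ((∑' n, P n) * ((Real.pi : ℂ) ^ 2 / sin ((Real.pi : ℂ) * x) ^ 2)) := by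
  have hQ := hasSum_inv_add_intCast_sq hx
  have hs := summable_mul_of_summable_norm (f := fun k : ℤ => ((x + k) ^ 2)⁻¹) (g := P)
    hQ.summable.norm hP.norm
  have h1 := HasSum.comp_int_add_nat (hQ.mul hP.hasSum hs)
  have h2 := h1.prod_fiberwise fun k => (h1.summable.prod_factor k).hasSum
  rw [mul_comm (∑' n, P n)]
  simpa only [mul_comm (P _)] using h2

section Bilateral

variable {ι κ : Type*} [Fintype ι] [Fintype κ] [DecidableEq ι]

/-- The bilateral sum of the derivative of a balanced ratio of Gamma functions. -/
theorem hasSum_deriv_prod_Gamma_div_prod_Gamma (hcard : Fintype.card ι = Fintype.card κ)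
    {a : ι → ℂ} {c : κ → ℂ} (ha : ∀ i, ∀ n : ℤ, a i ≠ n)
    (hab : ∀ i j, i ≠ j → ∀ n : ℤ, a i - a j ≠ n)
    (hre : 1 < ((∑ j, c j) - ∑ i, a i).re) :
    HasSum (fun k : ℤ => deriv (fun s => (∏ i, Gamma (a i + s)) / ∏ j, Gamma (c j + s)) k)
      (-∑ m, (∏ i ∈ Finset.univ.erase m, Gamma (a i - a m)) / (∏ j, Gamma (c j - a m)) *
        ((∑' n, rfRatio (fun i => 1 - (a i - a m)) (fun j => 1 - (c j - a m)) n) *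
          ((Real.pi : ℂ) ^ 2 / sin ((Real.pi : ℂ) * a m) ^ 2))) := by
  have hP : ∀ m, Summable (rfRatio (fun i => 1 - (a i - a m)) (fun j => 1 - (c j - a m))) := by
    intro m
    refine summable_rfRatio hcard (fun i n h => ?_) ?_
    · by_cases him : i = m
      · subst him
        exact absurd (show ((n + 1 : ℕ) : ℂ) = 0 by push_cast; linear_combination h)
          (by exact_mod_cast n.succ_ne_zero)
      · exact hab i m him (n + 1) (by push_cast; linear_combination -h)
    · rw [sum_const_sub_sub hcard]
      simp only [sub_re] at hre ⊢
      linarith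
  have h1 := hasSum_sum (s := Finset.univ) fun m _ =>
    (hasSum_tsum_mul_inv_sq (hP m) (ha m)).mul_left
      ((∏ i ∈ Finset.univ.erase m, Gamma (a i - a m)) / (∏ j, Gamma (c j - a m)))
  have hfun : (fun k : ℤ => deriv (fun s => (∏ i, Gamma (a i + s)) / ∏ j, Gamma (c j + s)) k) =
      fun k : ℤ => -∑ m, (∏ i ∈ Finset.univ.erase m, Gamma (a i - a m)) /
        (∏ j, Gamma (c j - a m)) *
        ∑' n : ℕ, rfRatio (fun i => 1 - (a i - a m)) (fun j => 1 - (c j - a m)) n *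
          ((a m + ((k + n : ℤ) : ℂ)) ^ 2)⁻¹ := by
    ext k
    have hev : (fun s => (∏ i, Gamma (a i + s)) / ∏ j, Gamma (c j + s)) =ᶠ[𝓝 (k : ℂ)]
        fun s => ∑ m, (∏ i ∈ Finset.univ.erase m, Gamma (a i - a m)) /
          (∏ j, Gamma (c j - a m)) *
          ∑' n : ℕ, rfRatio (fun i => 1 - (a i - a m)) (fun j => 1 - (c j - a m)) n /
            (s + a m + n) := by
      have hopen : ∀ᶠ s in 𝓝 (k : ℂ), ∀ i, s + a i ∈ (Set.range ((↑) : ℤ → ℂ))ᶜ := by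
        rw [eventually_all]
        intro i
        refine (Continuous.add_const continuous_id (a i)).continuousAt.eventually_mem
          (Complex.isOpen_compl_range_intCast.mem_nhds ?_)
        rintro ⟨n, hn⟩
        exact ha i (n - k) (by simp only [id] at hn; push_cast; linear_combination -hn)
      filter_upwards [hopen] with s hs
      exact prod_Gamma_div_prod_Gamma_eq_sum hcard hab hre fun i n h => hs i ⟨n, h.symm⟩
    rw [hev.deriv_eq, ← Finset.sum_neg_distrib]
    refine (HasDerivAt.fun_sum fun m _ => ?_).deriv
    rw [← mul_neg]
    exact (hasDerivAt_tsum_div (hP m) (ha m) k).const_mul _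
  rw [hfun]
  exact h1.neg

end Bilateral

theorem hasDerivAt_inv_Gamma_neg_natCast (n : ℕ) :
    HasDerivAt (fun s : ℂ => (Gamma s)⁻¹) ((-1) ^ n * (Nat.factorial n : ℂ)) (-n) := by
  have hrf : Differentiable ℂ fun s : ℂ => rf s n := by
    unfold rf
    fun_prop
  have hh : DifferentiableAt ℂ (fun s : ℂ => rf s n * (Gamma (s + (n + 1 : ℕ)))⁻¹) (-n) :=
    (hrf _).mul ((differentiable_one_div_Gamma.comp
      (differentiable_id.add_const (((n + 1 : ℕ) : ℂ)))) _)
  have h1 := ((hasDerivAt_id (-n : ℂ)).add_const (n : ℂ)).fun_mul hh.hasDerivAt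
  have e : (fun s : ℂ => (Gamma s)⁻¹) =
      fun s => (id s + n) * (rf s n * (Gamma (s + (n + 1 : ℕ)))⁻¹) := by
    ext s
    rw [inv_Gamma_eq_rf_mul s (n + 1), rf_succ, id]
    ring
  rw [e]
  refine h1.congr_deriv ?_
  have h2 : rf (-(n : ℂ)) n = (-1) ^ n * (Nat.factorial n : ℂ) := by
    have := rf_sub_natCast 0 n
    rwa [zero_sub, sub_zero, rf_one_left] at this
  simp [h2]

theorem Gamma_add_neg_natCast {x : ℂ} (hx : ∀ k : ℤ, x ≠ k) (n : ℕ) :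
    Gamma x = (-1) ^ (n + 1) * ((1 - x) * rf (2 - x) n) * Gamma (x + (-(n + 1) : ℂ)) := by
  have h := Gamma_add_natCast (x := x + (-(n + 1) : ℂ))
    (fun m h => hx (n + 1 - m) (by push_cast; linear_combination h)) (n + 1)
  have e1 : x + (-(n + 1) : ℂ) + ((n + 1 : ℕ) : ℂ) = x := by push_cast; ring
  have e2 : x + (-(n + 1) : ℂ) = x - ((n + 1 : ℕ) : ℂ) := by push_cast; ring
  have e3 : rf (1 - x) (n + 1) = (1 - x) * rf (2 - x) n := by
    rw [add_comm n 1, rf_add, rf_one_right]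
    congr 2
    push_cast
    ring
  rw [e1, e2, rf_sub_natCast, e3] at h
  rw [e2]
  exact h

section Evaluation

variable {ι κ : Type*} [Fintype ι] [Fintype κ]

theorem differentiableAt_prod_Gamma_div_prod_Gamma {x : ι → ℂ} {y : κ → ℂ} {s : ℂ}
    (hx : ∀ i, ∀ n : ℕ, x i + s ≠ -n) (hy : ∀ j, ∀ n : ℕ, y j + s ≠ -n) :
    DifferentiableAt ℂ (fun s => (∏ i, Gamma (x i + s)) / ∏ j, Gamma (y j + s)) s := by
  have h : ∀ {z : ℂ}, (∀ n : ℕ, z + s ≠ -n) → DifferentiableAt ℂ (fun s => Gamma (z + s)) s :=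
    fun {z} hz => (differentiableAt_Gamma _ hz).comp s (differentiableAt_id.const_add z)
  refine DifferentiableAt.fun_div (DifferentiableAt.fun_finsetProd fun i _ => h (hx i))
    (DifferentiableAt.fun_finsetProd fun j _ => h (hy j)) ?_
  exact Finset.prod_ne_zero_iff.mpr fun j _ => Gamma_ne_zero (hy j)

theorem deriv_prod_Gamma_div_prod_Gamma {x : ι → ℂ} {y : κ → ℂ} {s : ℂ}
    (hx : ∀ i, ∀ n : ℕ, x i + s ≠ -n) (hy : ∀ j, ∀ n : ℕ, y j + s ≠ -n) :
    deriv (fun s => (∏ i, Gamma (x i + s)) / ∏ j, Gamma (y j + s)) s =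
      (∏ i, Gamma (x i + s)) / (∏ j, Gamma (y j + s)) *
        ((∑ i, ψ (x i + s)) - ∑ j, ψ (y j + s)) := by
  have hd : ∀ {z : ℂ}, (∀ n : ℕ, z + s ≠ -n) → DifferentiableAt ℂ (fun s => Gamma (z + s)) s :=
    fun {z} hz => (differentiableAt_Gamma _ hz).comp s (differentiableAt_id.const_add z)
  have hl : ∀ z : ℂ, logDeriv (fun s => Gamma (z + s)) s = ψ (z + s) := fun z => by
    rw [logDeriv_apply, deriv_comp_const_add, ψ]
  have hx0 := Finset.prod_ne_zero_iff.mpr fun i (_ : i ∈ Finset.univ) => Gamma_ne_zero (hx i)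
  have hy0 := Finset.prod_ne_zero_iff.mpr fun j (_ : j ∈ Finset.univ) => Gamma_ne_zero (hy j)
  have h1 := logDeriv_div (f := fun s => ∏ i, Gamma (x i + s)) (g := fun s => ∏ j, Gamma (y j + s))
    s hx0 hy0 (DifferentiableAt.fun_finsetProd fun i _ => hd (hx i))
    (DifferentiableAt.fun_finsetProd fun j _ => hd (hy j))
  rw [logDeriv_prod (f := fun i s => Gamma (x i + s)) (fun i _ => Gamma_ne_zero (hx i)) (fun i _ => hd (hx i)),
    logDeriv_prod (f := fun j s => Gamma (y j + s)) (fun j _ => Gamma_ne_zero (hy j)) (fun j _ => hd (hy j)), logDeriv_apply] at h1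
  simp only [hl] at h1
  rw [← h1, mul_div_cancel₀ _ (div_ne_zero hx0 hy0)]

theorem deriv_prod_Gamma_div_prod_Gamma_natCast {a : ι → ℂ} {b : κ → ℂ}
    (ha : ∀ i, ∀ n : ℤ, a i ≠ n) (hb : ∀ j, ∀ n : ℤ, b j ≠ n) (n : ℕ) :
    deriv (fun s => (∏ i, Gamma (a i + s)) / ∏ o : Option κ, Gamma (o.elim 1 b + s)) n =
      -((∏ i, Gamma (a i)) / ∏ j, Gamma (b j)) *
        (((∏ i, rf (a i) n) / ((∏ j, rf (b j) n) * (Nat.factorial n : ℂ))) *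
          ((∑ j, ψ (b j + n)) + ψ (1 + n) - ∑ i, ψ (a i + n))) := by
  have hz : ∀ {z : ℂ}, (∀ m : ℤ, z ≠ m) → ∀ m : ℕ, z + n ≠ -m := fun hz m h =>
    hz (-m - n) (by push_cast; linear_combination h)
  have hz0 : ∀ {z : ℂ}, (∀ m : ℤ, z ≠ m) → ∀ m : ℕ, z ≠ -m := fun hz m h =>
    hz (-m) (by push_cast; exact h)
  have hone : ∀ m : ℕ, (1 : ℂ) + n ≠ -m := fun m h => by
    have : ((1 + n + m : ℕ) : ℂ) = 0 := by push_cast; linear_combination h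
    rw [Nat.cast_eq_zero] at this
    omega
  rw [deriv_prod_Gamma_div_prod_Gamma (fun i => hz (ha i)) (fun o => by
    cases o with
    | none => exact hone
    | some j => exact hz (hb j)), Fintype.prod_option, Fintype.sum_option]
  simp only [Option.elim]
  rw [Finset.prod_congr rfl fun i _ => Gamma_add_natCast (hz0 (ha i)) n,
    Finset.prod_congr rfl fun j _ => Gamma_add_natCast (hz0 (hb j)) n, add_comm (1 : ℂ) n,
    Gamma_nat_eq_factorial, Finset.prod_mul_distrib, Finset.prod_mul_distrib]
  ring

theorem deriv_prod_Gamma_div_prod_Gamma_negSucc (hcard : Fintype.card ι = Fintype.card κ + 1)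
    {a : ι → ℂ} {b : κ → ℂ} (ha : ∀ i, ∀ n : ℤ, a i ≠ n) (hb : ∀ j, ∀ n : ℤ, b j ≠ n) (n : ℕ) :
    deriv (fun s => (∏ i, Gamma (a i + s)) / ∏ o : Option κ, Gamma (o.elim 1 b + s))
        (-(n + 1)) =
      -((∏ i, Gamma (a i)) / ∏ j, Gamma (b j)) * ((∏ j, (1 - b j)) / (∏ i, (1 - a i))) *
        (((Nat.factorial n : ℂ) * ∏ j, rf (2 - b j) n) / ∏ i, rf (2 - a i) n) := by
  have hz : ∀ {z : ℂ}, (∀ m : ℤ, z ≠ m) → ∀ m : ℕ, z + -(n + 1 : ℂ) ≠ -m := fun hz m h =>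
    hz (n + 1 - m) (by push_cast; linear_combination h)
  have h1 : HasDerivAt (fun s : ℂ => (Gamma (1 + s))⁻¹) ((-1) ^ n * (Nat.factorial n : ℂ))
      (-(n + 1)) := by
    have h := hasDerivAt_inv_Gamma_neg_natCast n
    rw [show (-n : ℂ) = 1 + -(n + 1) by ring] at h
    exact h.comp_const_add 1 _
  have h0 : (Gamma (1 + -(n + 1 : ℂ)))⁻¹ = 0 := by
    rw [show 1 + -(n + 1 : ℂ) = -n by ring, Gamma_neg_nat_eq_zero, inv_zero]
  have h2 := ((differentiableAt_prod_Gamma_div_prod_Gamma (fun i => hz (ha i))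
    (fun j => hz (hb j))).hasDerivAt.fun_mul h1).deriv
  have e : (fun s => (∏ i, Gamma (a i + s)) / ∏ o : Option κ, Gamma (o.elim 1 b + s)) =
      fun s => (∏ i, Gamma (a i + s)) / (∏ j, Gamma (b j + s)) * (Gamma (1 + s))⁻¹ := by
    ext s
    rw [Fintype.prod_option]
    simp only [Option.elim]
    rw [← div_eq_mul_inv, div_div, mul_comm (Gamma _)]
  rw [e, h2, h0, mul_zero, zero_add,
    Finset.prod_congr rfl fun i _ => Gamma_add_neg_natCast (ha i) n,
    Finset.prod_congr rfl fun j _ => Gamma_add_neg_natCast (hb j) n]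
  simp only [Finset.prod_mul_distrib, Finset.prod_const, Finset.card_univ, hcard]
  have hne : ∀ {z : ℂ}, (∀ m : ℤ, z ≠ m) → ∀ m : ℕ, 1 + (m : ℂ) - z ≠ 0 := fun hz m h =>
    hz (1 + m) (by push_cast; linear_combination -h)
  have p1 : ∏ i, (1 - a i) ≠ 0 := Finset.prod_ne_zero_iff.mpr fun i _ => by
    simpa using hne (ha i) 0
  have p2 : ∏ j, (1 - b j) ≠ 0 := Finset.prod_ne_zero_iff.mpr fun j _ => by
    simpa using hne (hb j) 0
  have hrf : ∀ {z : ℂ}, (∀ m : ℤ, z ≠ m) → rf (2 - z) n ≠ 0 := fun hz =>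
    rf_ne_zero (fun m h => hz (2 + m) (by push_cast; linear_combination -h)) n
  have p3 : ∏ i, rf (2 - a i) n ≠ 0 := Finset.prod_ne_zero_iff.mpr fun i _ => hrf (ha i)
  have p4 : ∏ j, rf (2 - b j) n ≠ 0 := Finset.prod_ne_zero_iff.mpr fun j _ => hrf (hb j)
  have p5 : ∏ j, Gamma (b j + -(n + 1 : ℂ)) ≠ 0 := Finset.prod_ne_zero_iff.mpr fun j _ =>
    Gamma_ne_zero (hz (hb j))
  have p6 : ((-1 : ℂ) ^ (n + 1)) ≠ 0 := pow_ne_zero _ (by norm_num)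
  have p8 : (((-1 : ℂ) ^ (n + 1)) ^ Fintype.card κ) ≠ 0 := pow_ne_zero _ p6
  rw [pow_succ ((-1 : ℂ) ^ (n + 1)) (Fintype.card κ)]
  generalize ((-1 : ℂ) ^ (n + 1)) ^ Fintype.card κ = u at p8 ⊢
  field_simp
  ring

end Evaluation

/-- The coefficients of the bilateral sum rewritten with the reflection formula. -/
theorem prod_Gamma_div_mul_tsum_rfRatio {ι κ : Type*} [Fintype ι] [Fintype κ] [DecidableEq ι] {a : ι → ℂ}
    (ha : ∀ i, ∀ n : ℤ, a i ≠ n) (b : κ → ℂ) (m : ι) :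
    (∏ i ∈ Finset.univ.erase m, Gamma (a i - a m)) /
        (∏ o : Option κ, Gamma (o.elim 1 b - a m)) *
      ((∑' n, rfRatio (fun i => 1 - (a i - a m)) (fun o : Option κ => 1 - (o.elim 1 b - a m)) n) *
        ((Real.pi : ℂ) ^ 2 / sin ((Real.pi : ℂ) * a m) ^ 2)) =
      ((Real.pi : ℂ) * Gamma (a m) * (∏ i ∈ Finset.univ.erase m, Gamma (a i - a m)) /
          (sin ((Real.pi : ℂ) * a m) * ∏ j, Gamma (b j - a m))) *
        ∑' n : ℕ, (rf (a m) n * ∏ j, rf (1 - b j + a m) n) /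
          ((∏ i ∈ Finset.univ.erase m, rf (1 - a i + a m) n) * (Nat.factorial n : ℂ)) := by
  have hP : ∀ n, rfRatio (fun i => 1 - (a i - a m))
      (fun o : Option κ => 1 - (o.elim 1 b - a m)) n =
      (rf (a m) n * ∏ j, rf (1 - b j + a m) n) /
          ((∏ i ∈ Finset.univ.erase m, rf (1 - a i + a m) n) * (Nat.factorial n : ℂ)) := by
    intro n
    rw [rfRatio, Fintype.prod_option, ← Finset.prod_erase_mul _ _ (Finset.mem_univ m)]
    simp only [Option.elim, sub_self, sub_zero, rf_one_left, sub_sub_cancel, sub_sub_eq_add_sub,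
      sub_add_eq_add_sub]
  have hG : Gamma (1 - a m) ≠ 0 := Gamma_ne_zero fun n h =>
    ha m (1 + n) (by push_cast; linear_combination -h)
  have hs : sin ((Real.pi : ℂ) * a m) ≠ 0 := sin_pi_mul_ne_zero fun ⟨k, hk⟩ => ha m k hk.symm
  have hr : (Real.pi : ℂ) / sin ((Real.pi : ℂ) * a m) = Gamma (a m) * Gamma (1 - a m) :=
    (Gamma_mul_Gamma_one_sub _).symm
  simp only [hP]
  rw [Fintype.prod_option, ← div_pow, sq]
  nth_rewrite 1 [hr]
  simp only [Option.elim]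
  field_simp

theorem HasSum.eq_tsum_nat_add_tsum_neg_add_one {f : ℤ → ℂ} {S : ℂ} (h : HasSum f S) :
    S = (∑' n : ℕ, f n) + ∑' n : ℕ, f (-(n + 1)) := by
  have h1 : Summable fun n : ℕ => f n := h.summable.comp_injective Nat.cast_injective
  have h2 : Summable fun n : ℕ => f (-(n + 1)) :=
    h.summable.comp_injective (i := fun n : ℕ => -((n : ℤ) + 1)) fun m n hmn => by
      simpa using hmn
  rw [← h.tsum_eq, tsum_of_nat_of_neg_add_one h1 h2]

theorem stmt14 (p : ℕ) (hp : 2 ≤ p) (a : Fin p → ℂ) (b : Fin (p - 1) → ℂ)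
    (ha : ∀ i, ∀ n : ℤ, a i ≠ n)
    (hab : ∀ i j, i ≠ j → ∀ n : ℤ, a i - a j ≠ n)
    (hb : ∀ j, ∀ n : ℤ, b j ≠ n)
    (hre : 0 < ((∑ j, b j) - ∑ i, a i).re) :
    (∑' k : ℕ, ((∏ i, rf (a i) k) / ((∏ j, rf (b j) k) * (Nat.factorial k : ℂ))) *
        ((∑ j, ψ (b j + k)) + ψ (1 + k) - ∑ i, ψ (a i + k))) =
      ((∏ j, Complex.Gamma (b j)) / (∏ i, Complex.Gamma (a i))) *
        (∑ m : Fin p,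
          ((Real.pi : ℂ) * Complex.Gamma (a m) *
              (∏ i ∈ Finset.univ.erase m, Complex.Gamma (a i - a m)) /
            (Complex.sin ((Real.pi : ℂ) * a m) *
              ∏ j, Complex.Gamma (b j - a m))) *
          (∑' n : ℕ, (rf (a m) n * ∏ j, rf (1 - b j + a m) n) /
            ((∏ i ∈ Finset.univ.erase m, rf (1 - a i + a m) n) * (Nat.factorial n : ℂ)))) -
      ((∏ j, (1 - b j)) / (∏ i, (1 - a i))) *
        (∑' n : ℕ, ((Nat.factorial n : ℂ) * ∏ j, rf (2 - b j) n) /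
          ∏ i, rf (2 - a i) n) := by
  have hcard : Fintype.card (Fin p) = Fintype.card (Fin (p - 1)) + 1 := by
    simp only [Fintype.card_fin]
    omega
  have hcard' : Fintype.card (Fin p) = Fintype.card (Option (Fin (p - 1))) := by
    rw [Fintype.card_option, hcard]
  have hz : ∀ {z : ℂ}, (∀ m : ℤ, z ≠ m) → Gamma z ≠ 0 := fun h =>
    Gamma_ne_zero fun n hn => h (-n) (by push_cast; exact hn)
  have hC : (∏ i, Gamma (a i)) / ∏ j, Gamma (b j) ≠ 0 :=
    div_ne_zero (Finset.prod_ne_zero_iff.mpr fun i _ => hz (ha i))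
      (Finset.prod_ne_zero_iff.mpr fun j _ => hz (hb j))
  have h := hasSum_deriv_prod_Gamma_div_prod_Gamma hcard'
    (c := fun o : Option (Fin (p - 1)) => o.elim 1 b) ha hab (by
      rw [Fintype.sum_option]
      simp only [Option.elim, sub_re, add_re, one_re] at hre ⊢
      linarith)
  have h2 := HasSum.eq_tsum_nat_add_tsum_neg_add_one h
  push_cast at h2
  simp only [deriv_prod_Gamma_div_prod_Gamma_natCast ha hb,
    deriv_prod_Gamma_div_prod_Gamma_negSucc hcard ha hb, tsum_mul_left,
    prod_Gamma_div_mul_tsum_rfRatio ha b] at h2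
  refine mul_left_cancel₀ hC ?_
  rw [← inv_div (∏ i, Gamma (a i)), mul_sub, mul_inv_cancel_left₀ hC]
  linear_combination h2
end

section
/- Let a, b, c be complex numbers with c not a nonpositive integer and Re(c - a - b) > 0. Then the series Σ_{k=0}^∞ (a)_k (b)_k / ((c)_k k!) · [ψ(c+k) + ψ(1+k) - ψ(a+k) - ψ(b+k)] converges absolutely. -/
open Complex Finset

open Filter Asymptotics Topology

theorem isBigO_inv_add_natCast (s : ℂ) :
    (fun n : ℕ => (s + n)⁻¹) =O[atTop] fun n : ℕ => (n : ℝ)⁻¹ := by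
  have h := (tendsto_natCast_div_add_atTop s).isBigO_one ℝ
  have hinv : (fun n : ℕ => (n : ℂ)⁻¹) =O[atTop] fun n : ℕ => (n : ℝ)⁻¹ :=
    isBigO_of_le _ fun n => by simp
  refine (hinv.mul h).congr' ?_ (by simp)
  filter_upwards [eventually_ne_atTop 0] with n hn
  have hn' : (n : ℂ) ≠ 0 := Nat.cast_ne_zero.2 hn
  rw [div_eq_mul_inv, inv_mul_cancel_left₀ hn', add_comm]

theorem add_natCast_ne_neg_natCast {s : ℂ} (hs : ∀ n : ℕ, s ≠ -n) (k n : ℕ) : s + k ≠ -n := by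
  intro h
  refine hs (n + k) ?_
  push_cast
  linear_combination h

theorem ψ_add_natCast_succ {s : ℂ} (hs : ∀ n : ℕ, s ≠ -n) (k : ℕ) :
    ψ (s + (k + 1 : ℕ)) = ψ (s + k) + (s + k)⁻¹ := by
  rw [Nat.cast_succ, ← add_assoc]
  exact digamma_apply_add_one _ (add_natCast_ne_neg_natCast hs k)

theorem isBigO_ψ_sub_ψ {s t : ℂ} (hs : ∀ n : ℕ, s ≠ -n) (ht : ∀ n : ℕ, t ≠ -n) :
    (fun k : ℕ => ψ (s + k) - ψ (t + k)) =O[atTop] fun _ => (1 : ℝ) := by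
  have hO : (fun k : ℕ => (s + k)⁻¹ - (t + k)⁻¹) =O[atTop] fun k : ℕ => ((k : ℝ) ^ 2)⁻¹ := by
    refine (((isBigO_inv_add_natCast s).mul (isBigO_inv_add_natCast t)).const_mul_left
      (t - s)).congr (fun k => ?_) fun k => by rw [pow_two, mul_inv]
    have h₁ : s + k ≠ 0 := by simpa using add_natCast_ne_neg_natCast hs k 0
    have h₂ : t + k ≠ 0 := by simpa using add_natCast_ne_neg_natCast ht k 0
    field_simp
    ring
  have hsum := summable_of_isBigO_nat (Real.summable_nat_pow_inv.2 one_lt_two) hO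
  have hpartial (n : ℕ) : ∑ k ∈ range n, ((s + k)⁻¹ - (t + k)⁻¹) + (ψ s - ψ t) =
      ψ (s + n) - ψ (t + n) := by
    induction n with
    | zero => simp
    | succ n ih =>
      rw [sum_range_succ, ψ_add_natCast_succ hs, ψ_add_natCast_succ ht]
      linear_combination ih
  exact ((hsum.hasSum.tendsto_sum_nat.add_const _).congr hpartial).isBigO_one ℝ

theorem rf_succ_eq_div_GammaSeq {s : ℂ} (hs : ∀ n : ℕ, s ≠ -n) {n : ℕ} (hn : n ≠ 0) :
    rf s (n + 1) = (n : ℂ) ^ s * (n.factorial : ℂ) / GammaSeq s n := by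
  have hn' : (n : ℂ) ≠ 0 := Nat.cast_ne_zero.2 hn
  have hpow : (n : ℂ) ^ s ≠ 0 := by simp [cpow_eq_zero_iff, hn]
  have hfac : (n.factorial : ℂ) ≠ 0 := Nat.cast_ne_zero.2 n.factorial_ne_zero
  have hrf : rf s (n + 1) ≠ 0 := prod_ne_zero_iff.2 fun k _ => by
    simpa using add_natCast_ne_neg_natCast hs k 0
  change _ = _ / (_ / rf s (n + 1))
  field_simp

theorem isBigO_hypergeometric_coeff {a b c : ℂ} (ha : ∀ n : ℕ, a ≠ -n) (hb : ∀ n : ℕ, b ≠ -n)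
    (hc : ∀ n : ℕ, c ≠ -n) :
    (fun n : ℕ => rf a (n + 1) * rf b (n + 1) / (rf c (n + 1) * ((n + 1).factorial : ℂ)))
      =O[atTop] fun n : ℕ => (n : ℝ) ^ ((a + b - c).re - 1) := by
  have hquot := ((GammaSeq_tendsto_Gamma c).div
    ((GammaSeq_tendsto_Gamma a).mul (GammaSeq_tendsto_Gamma b))
    (mul_ne_zero (Gamma_ne_zero ha) (Gamma_ne_zero hb))).isBigO_one ℝ
  have hpow : (fun n : ℕ => (n : ℂ) ^ (a + b - c)) =O[atTop]
      fun n : ℕ => (n : ℝ) ^ (a + b - c).re := by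
    refine IsBigO.of_bound 1 ?_
    filter_upwards [eventually_gt_atTop 0] with n hn
    rw [norm_natCast_cpow_of_pos hn, one_mul]
    exact le_abs_self _
  refine ((hpow.mul (isBigO_inv_add_natCast 1)).mul hquot).congr' ?_ ?_
  · filter_upwards [eventually_ne_atTop 0] with n hn
    have hn' : (n : ℂ) ≠ 0 := Nat.cast_ne_zero.2 hn
    have hfac : (n.factorial : ℂ) ≠ 0 := Nat.cast_ne_zero.2 n.factorial_ne_zero
    have hc' : (n : ℂ) ^ c ≠ 0 := by simp [cpow_eq_zero_iff, hn]
    have hsucc : (1 + n : ℂ) ≠ 0 := by rw [add_comm]; exact n.cast_add_one_ne_zero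
    rw [rf_succ_eq_div_GammaSeq ha hn, rf_succ_eq_div_GammaSeq hb hn,
      rf_succ_eq_div_GammaSeq hc hn, cpow_sub _ _ hn', cpow_add _ _ hn', Nat.factorial_succ]
    push_cast
    rw [add_comm (n : ℂ) 1]
    simp only [div_eq_mul_inv, mul_inv, inv_inv, Pi.div_apply]
    field_simp
  · filter_upwards [eventually_ne_atTop 0] with n hn
    rw [Real.rpow_sub_one (Nat.cast_ne_zero.2 hn), mul_one, div_eq_mul_inv]

theorem stmt16 (a b c : ℂ) (hc : ∀ n : ℕ, c ≠ -n)
    (ha : ∀ k : ℕ, ∀ n : ℕ, a + k ≠ -n) (hb' : ∀ k : ℕ, ∀ n : ℕ, b + k ≠ -n)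
    (hre : 0 < (c - a - b).re) :
    Summable (fun k : ℕ => ‖rf a k * rf b k / (rf c k * (Nat.factorial k : ℂ)) *
        (ψ (c + k) + ψ (1 + k) - ψ (a + k) - ψ (b + k))‖) := by
  have ha' : ∀ n : ℕ, a ≠ -n := by simpa using ha 0
  have hb : ∀ n : ℕ, b ≠ -n := by simpa using hb' 0
  have h1 (n : ℕ) : (1 : ℂ) ≠ -n := fun h => n.cast_add_one_ne_zero (R := ℂ) (by rw [h]; ring)
  have hψ : (fun k : ℕ => ψ (c + k) + ψ (1 + k) - ψ (a + k) - ψ (b + k)) =O[atTop]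
      fun _ => (1 : ℝ) :=
    ((isBigO_ψ_sub_ψ hc ha').add (isBigO_ψ_sub_ψ h1 hb)).congr_left fun k => by ring
  rw [← summable_nat_add_iff 1]
  have hre' : (a + b - c).re - 1 < -1 := by
    simp only [sub_re, add_re] at hre ⊢
    linarith
  refine summable_of_isBigO_nat (Real.summable_nat_rpow.2 hre') ?_
  refine (((isBigO_hypergeometric_coeff ha' hb hc).mul
    (hψ.comp_tendsto (tendsto_add_atTop_nat 1))).norm_left).congr_right fun n => ?_
  exact mul_one _
end
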